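/- Fix (u,v,w) ∈ ℝ³ with w ≠ 0, write (u¹,u²,u³) = (u,v,w), and suppose the cubic P(X) = X³ + ¼(u² − 18uw − 12v − 27w²)X² − (u³w + ½u²v − (9/2)uvw − 3v²)X + ¼u²v² − v³ has three distinct real roots λ¹, λ², λ³. For each i define the vector J^i ∈ ℝ³ with components J^i_α = −(∂P/∂u^α)(λ^i)/(∂P/∂X)(λ^i) for α = 1,2,3 (the gradient of the simple root λ^i regarded as a function of (u,v,w)); set f^i = (J^i)ᵀ η_U J^i, and for a 3×3 matrix T write T^{ki} = (J^k)ᵀ T J^i. Assume f¹, f², f³ are all nonzero. Then for each i = 1,2,3 the central invariant c_i := (1/(3(f^i)²)) [ K₂^{ii} − λ^i K₁^{ii} + Σ_{k≠i} (H₂^{ki} − λ^i H₁^{ki})² / (f^k (λ^k − λ^i)) ] equals 1/24. -/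

import Mathlib

/-- The contravariant metric of the first Hamiltonian structure P₁ in (u,v,w) coordinates. -/
noncomputable def etaU (u v w : ℝ) : Matrix (Fin 3) (Fin 3) ℝ :=
  !![2, -3*w, 0; -3*w, -2*u*w, w; 0, w, 0]

/-- The contravariant metric of the second Hamiltonian structure P₂ in (u,v,w) coordinates. -/
noncomputable def gU (u v w : ℝ) : Matrix (Fin 3) (Fin 3) ℝ :=
  !![2*v - (1/2)*u^2, 0, (1/2)*u*w;
     0, 0, v*w;
     (1/2)*u*w, v*w, (3/2)*w^2]

/-- Leading dispersive coefficient H₁ of P₁. -/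
noncomputable def H1 (u v w : ℝ) : Matrix (Fin 3) (Fin 3) ℝ :=
  !![0, -(3/2)*w, 0; (3/2)*w, 0, (1/2)*w; 0, -(1/2)*w, 0]

/-- Leading dispersive coefficient K₁ of P₁. -/
noncomputable def K1 (u v w : ℝ) : Matrix (Fin 3) (Fin 3) ℝ :=
  !![1/3, -(3/2)*w, 0; -(3/2)*w, -(1/3)*u*w, (1/6)*w; 0, (1/6)*w, 0]

/-- Leading dispersive coefficient H₂ of P₂. -/
noncomputable def H2 (u v w : ℝ) : Matrix (Fin 3) (Fin 3) ℝ :=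
  !![0, 0, (1/2)*u*w; 0, 0, (1/2)*v*w; -(1/2)*u*w, -(1/2)*v*w, 0]

/-- Leading dispersive coefficient K₂ of P₂. -/
noncomputable def K2 (u v w : ℝ) : Matrix (Fin 3) (Fin 3) ℝ :=
  !![(1/24)*u^2 + (1/3)*v, 0, (5/24)*u*w;
     0, 0, (1/6)*v*w;
     (5/24)*u*w, (1/6)*v*w, (3/8)*w^2]

/-- The characteristic cubic P(X). -/
noncomputable def Pchar (u v w X : ℝ) : ℝ :=
  X^3 + (1/4)*(u^2 - 18*u*w - 12*v - 27*w^2)*X^2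
    - (u^3*w + (1/2)*u^2*v - (9/2)*u*v*w - 3*v^2)*X
    + (1/4)*u^2*v^2 - v^3

/-- The partial derivatives ∂P/∂u^α, α = 1,2,3, with (u¹,u²,u³) = (u,v,w). -/
noncomputable def PcharD (u v w X : ℝ) : Fin 3 → ℝ :=
  ![deriv (fun t => Pchar t v w X) u,
    deriv (fun t => Pchar u t w X) v,
    deriv (fun t => Pchar u v t X) w]

/-- The derivative ∂P/∂X. -/
noncomputable def PcharX (u v w X : ℝ) : ℝ := deriv (fun t => Pchar u v w t) X

/-- The gradient vector J^i of a simple root λ of P: J_α = −(∂P/∂u^α)(λ)/(∂P/∂X)(λ). -/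
noncomputable def Jvec (u v w lam : ℝ) : Fin 3 → ℝ :=
  fun a => -(PcharD u v w lam a) / PcharX u v w lam

/-- The bilinear pairing aᵀ T b for a 3×3 matrix T. -/
noncomputable def quadF (T : Matrix (Fin 3) (Fin 3) ℝ) (a b : Fin 3 → ℝ) : ℝ :=
  ∑ i : Fin 3, ∑ j : Fin 3, a i * T i j * b j

/-- The polynomial `P` is, up to the factor `1/4`, the discriminant in `p` of
`p³ + u p² + (v - X) p + w X`, so a root of `P` gives a double root of that cubic. -/
theorem exists_double_root {u v w l : ℝ} (h : Pchar u v w l = 0) :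
    ∃ a, a ^ 3 + u * a ^ 2 + (v - l) * a + w * l = 0 ∧ l = 3 * a ^ 2 + 2 * u * a + v := by
  unfold Pchar at h
  by_cases hd : u ^ 2 - 3 * (v - l) = 0
  · obtain rfl : v = u ^ 2 / 3 + l := by linarith
    have h27 : (27 * (w * l) - u ^ 3) ^ 2 = 0 := by linear_combination -108 * h
    have hwl : 27 * (w * l) - u ^ 3 = 0 := by simpa using h27
    exact ⟨-u / 3, by linear_combination hwl / 27, by ring⟩
  · obtain ⟨D, rfl⟩ : ∃ D, v = l + (u ^ 2 - D) / 3 := ⟨u ^ 2 - 3 * (v - l), by ring⟩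
    have hD : D ≠ 0 := by
      contrapose! hd
      rw [hd]
      ring
    refine ⟨(9 * (w * l) - u * ((u ^ 2 - D) / 3)) / (2 * D), ?_, ?_⟩
    · field_simp
      linear_combination (-108 * (2 * u ^ 3 - 3 * u * (u ^ 2 - D) + 27 * (w * l))) * h
    · field_simp
      linear_combination 108 * h

theorem hasDerivAt_cubic (c₃ c₂ c₁ c₀ x : ℝ) :
    HasDerivAt (fun t => c₃ * t ^ 3 + c₂ * t ^ 2 + c₁ * t + c₀)
      (3 * c₃ * x ^ 2 + 2 * c₂ * x + c₁) x := by
  have h := ((((hasDerivAt_pow 3 x).const_mul c₃).add ((hasDerivAt_pow 2 x).const_mul c₂)).add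
    ((hasDerivAt_id x).const_mul c₁)).add_const c₀
  refine h.congr_deriv ?_
  norm_num
  ring

theorem PcharX_eq (u v w X : ℝ) :
    PcharX u v w X = 3 * X ^ 2 + (1 / 2) * (u ^ 2 - 18 * u * w - 12 * v - 27 * w ^ 2) * X
      - (u ^ 3 * w + (1 / 2) * u ^ 2 * v - (9 / 2) * u * v * w - 3 * v ^ 2) := by
  have h := hasDerivAt_cubic 1 ((1 / 4) * (u ^ 2 - 18 * u * w - 12 * v - 27 * w ^ 2))
    (-(u ^ 3 * w + (1 / 2) * u ^ 2 * v - (9 / 2) * u * v * w - 3 * v ^ 2))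
    ((1 / 4) * u ^ 2 * v ^ 2 - v ^ 3) X
  unfold PcharX
  convert h.deriv using 1
  · congr 1
    funext t
    unfold Pchar
    ring
  · ring

theorem PcharD_zero (u v w X : ℝ) :
    PcharD u v w X 0 = (1 / 2) * (u - 9 * w) * X ^ 2
      - (3 * u ^ 2 * w + u * v - (9 / 2) * v * w) * X + (1 / 2) * u * v ^ 2 := by
  have h := hasDerivAt_cubic (-(w * X)) ((1 / 4) * X ^ 2 - (1 / 2) * v * X + (1 / 4) * v ^ 2)
    (-(9 / 2) * w * X ^ 2 + (9 / 2) * v * w * X)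
    (X ^ 3 + (1 / 4) * (-12 * v - 27 * w ^ 2) * X ^ 2 + 3 * v ^ 2 * X - v ^ 3) u
  change deriv (fun t => Pchar t v w X) u = _
  convert h.deriv using 1
  · congr 1
    funext t
    unfold Pchar
    ring
  · ring

theorem PcharD_one (u v w X : ℝ) :
    PcharD u v w X 1 = -3 * X ^ 2 - ((1 / 2) * u ^ 2 - (9 / 2) * u * w - 6 * v) * X
      + (1 / 2) * u ^ 2 * v - 3 * v ^ 2 := by
  have h := hasDerivAt_cubic (-1) (3 * X + (1 / 4) * u ^ 2)
    (-3 * X ^ 2 - ((1 / 2) * u ^ 2 - (9 / 2) * u * w) * X)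
    (X ^ 3 + (1 / 4) * (u ^ 2 - 18 * u * w - 27 * w ^ 2) * X ^ 2 - u ^ 3 * w * X) v
  change deriv (fun t => Pchar u t w X) v = _
  convert h.deriv using 1
  · congr 1
    funext t
    unfold Pchar
    ring
  · ring

theorem PcharD_two (u v w X : ℝ) :
    PcharD u v w X 2 = -(9 / 2) * (u + 3 * w) * X ^ 2 - (u ^ 3 - (9 / 2) * u * v) * X := by
  have h := hasDerivAt_cubic 0 (-(27 / 4) * X ^ 2)
    (-(9 / 2) * u * X ^ 2 - (u ^ 3 - (9 / 2) * u * v) * X)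
    (X ^ 3 + (1 / 4) * (u ^ 2 - 12 * v) * X ^ 2 - ((1 / 2) * u ^ 2 * v - 3 * v ^ 2) * X
      + (1 / 4) * u ^ 2 * v ^ 2 - v ^ 3) w
  change deriv (fun t => Pchar u v t X) w = _
  convert h.deriv using 1
  · congr 1
    funext t
    unfold Pchar
    ring
  · ring

/-- The gradient of a critical value of `p (p² + u p + v) / (p - w)` at the critical point `a`. -/
theorem Jvec_eq {u v w l a : ℝ} (hw : w ≠ 0) (haw : a - w ≠ 0)
    (hP : PcharX u v w l ≠ 0)
    (hc : a ^ 3 + u * a ^ 2 + (v - l) * a + w * l = 0) (hl : l = 3 * a ^ 2 + 2 * u * a + v) :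
    Jvec u v w l = ![a ^ 2 / (a - w), a / (a - w), l / (a - w)] := by
  have hv : v = (2 * a ^ 3 + (u - 3 * w) * a ^ 2 - 2 * u * w * a) / w := by
    rw [eq_div_iff hw]
    subst hl
    linear_combination hc
  have hJ : ∀ (i : Fin 3) (q : ℝ), PcharD u v w l i * (a - w) + q * PcharX u v w l = 0 →
      Jvec u v w l i = q / (a - w) := by
    intro i q h
    unfold Jvec
    rw [div_eq_div_iff hP haw]
    linear_combination -h
  funext i
  fin_cases i
  · apply hJ
    simp only [Fin.zero_eta, PcharD_zero, PcharX_eq]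
    subst hl
    rw [hv]
    field_simp
    ring
  · apply hJ
    simp only [Fin.mk_one, PcharD_one, PcharX_eq]
    subst hl
    rw [hv]
    field_simp
    ring
  · apply hJ
    simp only [Fin.reduceFinMk, PcharD_two, PcharX_eq]
    subst hl
    rw [hv]
    field_simp
    ring

theorem PcharX_ne_zero {u v w l : ℝ} {T : Matrix (Fin 3) (Fin 3) ℝ}
    (hf : quadF T (Jvec u v w l) (Jvec u v w l) ≠ 0) : PcharX u v w l ≠ 0 := by
  intro h
  apply hf
  simp [quadF, Jvec, h]

/-- The data of three critical points `x + w`, `y + w`, `z + w` of `p (p² + u p + v) / (p - w)`. -/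
structure IsCritTriple (u v w x y z : ℝ) : Prop where
  sum_mul : x * y + x * z + y * z = 0
  u_eq : u = -2 * (x + y + z) - 3 * w
  v_mul : v * w = 2 * (x + w) * (y + w) * (z + w)

theorem IsCritTriple.swap {u v w x y z : ℝ} (h : IsCritTriple u v w x y z) :
    IsCritTriple u v w x z y :=
  ⟨by linear_combination h.sum_mul, by rw [h.u_eq]; ring, by rw [h.v_mul]; ring⟩

theorem IsCritTriple.rotate {u v w x y z : ℝ} (h : IsCritTriple u v w x y z) :
    IsCritTriple u v w y z x :=
  ⟨by linear_combination h.sum_mul, by rw [h.u_eq]; ring, by rw [h.v_mul]; ring⟩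

theorem isCritTriple_of_distinct {u v w a b c : ℝ}
    (ha : 2 * a ^ 3 + (u - 3 * w) * a ^ 2 - 2 * u * w * a - v * w = 0)
    (hb : 2 * b ^ 3 + (u - 3 * w) * b ^ 2 - 2 * u * w * b - v * w = 0)
    (hc : 2 * c ^ 3 + (u - 3 * w) * c ^ 2 - 2 * u * w * c - v * w = 0)
    (hab : a ≠ b) (hac : a ≠ c) (hbc : b ≠ c) :
    IsCritTriple u v w (a - w) (b - w) (c - w) := by
  have h₁ : 2 * (a ^ 2 + a * b + b ^ 2) + (u - 3 * w) * (a + b) - 2 * u * w = 0 := by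
    apply mul_left_cancel₀ (sub_ne_zero.2 hab)
    linear_combination ha - hb
  have h₂ : 2 * (a ^ 2 + a * c + c ^ 2) + (u - 3 * w) * (a + c) - 2 * u * w = 0 := by
    apply mul_left_cancel₀ (sub_ne_zero.2 hac)
    linear_combination ha - hc
  have h₃ : 2 * (a + b + c) + (u - 3 * w) = 0 := by
    apply mul_left_cancel₀ (sub_ne_zero.2 hbc)
    linear_combination h₁ - h₂
  obtain rfl : u = 3 * w - 2 * (a + b + c) := by linarith
  exact ⟨by linear_combination -h₁ / 2, by ring, by linear_combination -ha + a * h₁⟩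

theorem IsCritTriple.nondegenerate {u v w x y z : ℝ} (h : IsCritTriple u v w x y z)
    (hxy : x ≠ y) (hxz : x ≠ z) (hyz : y ≠ z) : x ≠ 0 ∧ x + y ≠ 0 := by
  have h0 := h.sum_mul
  constructor
  · rintro rfl
    have : y * z = 0 := by linear_combination h0
    rcases mul_eq_zero.1 this with rfl | rfl <;> simp at *
  · intro hs
    obtain rfl : y = -x := by linarith
    have : x ^ 2 = 0 := by linear_combination -h0
    have hx : x = 0 := by simpa using this
    simp [hx] at hxy

theorem IsCritTriple.third_eq {u v w x y z : ℝ} (h : IsCritTriple u v w x y z)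
    (hs : x + y ≠ 0) : z = -(x * y) / (x + y) := by
  rw [eq_div_iff hs]
  linear_combination h.sum_mul

/-- The critical value at `x + w`, for `p (p² + u p + v) / (p - w)`. -/
noncomputable def critVal (u v w x : ℝ) : ℝ := 3 * (x + w) ^ 2 + 2 * u * (x + w) + v

/-- The gradient of `critVal` at a critical point. -/
noncomputable def critGrad (u v w x : ℝ) : Fin 3 → ℝ :=
  ![(x + w) ^ 2 / x, (x + w) / x, critVal u v w x / x]

theorem quadF_etaU {u v w x y z : ℝ} (h : IsCritTriple u v w x y z) (hx : x ≠ 0) :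
    quadF (etaU u v w) (critGrad u v w x) (critGrad u v w x)
      = 2 * (x + w) ^ 2 * (x - y) * (x - z) / x ^ 2 := by
  have h0 := h.sum_mul
  have hv := h.v_mul
  simp only [quadF, etaU, critGrad, critVal, Fin.sum_univ_three, Matrix.of_apply,
    Matrix.cons_val]
  rw [h.u_eq]
  field_simp
  linear_combination 2 * (x + w) * hv + 2 * (x + w) ^ 2 * h0

theorem quadF_K {u v w x y z : ℝ} (h : IsCritTriple u v w x y z) (hw : w ≠ 0) (hx : x ≠ 0)
    (hs : x + y ≠ 0) :
    quadF (K2 u v w) (critGrad u v w x) (critGrad u v w x)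
        - critVal u v w x * quadF (K1 u v w) (critGrad u v w x) (critGrad u v w x)
      = (2 * (x + w) ^ 2 * (x - y) * (x - z) / x ^ 2) ^ 2 / 8 := by
  have hv := eq_div_of_mul_eq hw h.v_mul
  simp only [quadF, K1, K2, critGrad, critVal, Fin.sum_univ_three, Matrix.of_apply,
    Matrix.cons_val]
  rw [hv, h.u_eq, h.third_eq hs]
  field_simp
  ring

theorem quadF_H {u v w x y z : ℝ} (h : IsCritTriple u v w x y z) (hw : w ≠ 0) (hx : x ≠ 0)
    (hy : y ≠ 0) (hs : x + y ≠ 0) :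
    quadF (H2 u v w) (critGrad u v w y) (critGrad u v w x)
        - critVal u v w x * quadF (H1 u v w) (critGrad u v w y) (critGrad u v w x)
      = (x + w) ^ 2 * (y + w) * (y - x) ^ 3 * (x + 2 * y) / (x * (x + y) ^ 2) := by
  have hv := eq_div_of_mul_eq hw h.v_mul
  simp only [quadF, H1, H2, critGrad, critVal, Fin.sum_univ_three, Matrix.of_apply,
    Matrix.cons_val]
  rw [hv, h.u_eq, h.third_eq hs]
  field_simp
  ring

theorem critVal_sub {u v w x y z : ℝ} (h : IsCritTriple u v w x y z) (hs : x + y ≠ 0) :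
    critVal u v w y - critVal u v w x = -(y - x) ^ 3 / (x + y) := by
  simp only [critVal]
  rw [h.u_eq, h.third_eq hs]
  field_simp
  ring

theorem summand_eq {u v w x y z : ℝ} (h : IsCritTriple u v w x y z) (hw : w ≠ 0)
    (hx : x ≠ 0) (hy : y ≠ 0) (hs : x + y ≠ 0) (hxy : x ≠ y) (hyz : y ≠ z)
    (hyw : y + w ≠ 0) :
    (quadF (H2 u v w) (critGrad u v w y) (critGrad u v w x)
        - critVal u v w x * quadF (H1 u v w) (critGrad u v w y) (critGrad u v w x)) ^ 2
        / (quadF (etaU u v w) (critGrad u v w y) (critGrad u v w y)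
          * (critVal u v w y - critVal u v w x))
      = -(2 * (x + w) ^ 2 * (x - y) * (x - z) / x ^ 2) ^ 2 / 8 * (y / (2 * x + y)) := by
  have hz := h.third_eq hs
  have hyz' : y - z = y * (2 * x + y) / (x + y) := by
    rw [hz]
    field_simp
    ring
  have hxz' : x - z = x * (x + 2 * y) / (x + y) := by
    rw [hz]
    field_simp
    ring
  have h2 : 2 * x + y ≠ 0 := by
    intro h0
    apply sub_ne_zero.2 hyz
    rw [hyz', h0]
    simp
  have hyx : y - x ≠ 0 := sub_ne_zero.2 hxy.symm
  rw [quadF_H h hw hx hy hs, quadF_etaU h.rotate hy, critVal_sub h hs, hyz', hxz']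
  field_simp
  ring

theorem sum_ratio_eq_zero {x y z : ℝ} (h : x * y + x * z + y * z = 0) (hy : 2 * x + y ≠ 0)
    (hz : 2 * x + z ≠ 0) : y / (2 * x + y) + z / (2 * x + z) = 0 := by
  field_simp
  linear_combination 2 * h

theorem central_invariant_crit {u v w x y z : ℝ} (h : IsCritTriple u v w x y z) (hw : w ≠ 0)
    (hxy : x ≠ y) (hxz : x ≠ z) (hyz : y ≠ z)
    (hxw : x + w ≠ 0) (hyw : y + w ≠ 0) (hzw : z + w ≠ 0) :
    (1 / (3 * (quadF (etaU u v w) (critGrad u v w x) (critGrad u v w x)) ^ 2)) *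
      (quadF (K2 u v w) (critGrad u v w x) (critGrad u v w x)
        - critVal u v w x * quadF (K1 u v w) (critGrad u v w x) (critGrad u v w x)
        + ((quadF (H2 u v w) (critGrad u v w y) (critGrad u v w x)
        - critVal u v w x * quadF (H1 u v w) (critGrad u v w y) (critGrad u v w x)) ^ 2
        / (quadF (etaU u v w) (critGrad u v w y) (critGrad u v w y)
          * (critVal u v w y - critVal u v w x))
        + (quadF (H2 u v w) (critGrad u v w z) (critGrad u v w x)
        - critVal u v w x * quadF (H1 u v w) (critGrad u v w z) (critGrad u v w x)) ^ 2
        / (quadF (etaU u v w) (critGrad u v w z) (critGrad u v w z)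
          * (critVal u v w z - critVal u v w x)))) = 1 / 24 := by
  obtain ⟨hx, hsy⟩ := h.nondegenerate hxy hxz hyz
  obtain ⟨-, hsz⟩ := h.swap.nondegenerate hxz hxy hyz.symm
  obtain ⟨hy, -⟩ := h.rotate.nondegenerate hyz hxy.symm hxz.symm
  obtain ⟨hz, -⟩ := h.rotate.rotate.nondegenerate hxz.symm hyz.symm hxy
  have h2y : 2 * x + y ≠ 0 := fun h0 => by
    obtain rfl : y = -2 * x := by linarith
    refine hyz (mul_left_cancel₀ hx ?_)
    linear_combination h.sum_mul
  have h2z : 2 * x + z ≠ 0 := fun h0 => by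
    obtain rfl : z = -2 * x := by linarith
    refine hyz (mul_left_cancel₀ hx ?_)
    linear_combination -h.sum_mul
  rw [summand_eq h hw hx hy hsy hxy hyz hyw, summand_eq h.swap hw hx hz hsz hxz hyz.symm hzw,
    quadF_K h hw hx hsy, quadF_etaU h hx]
  have hsum := sum_ratio_eq_zero h.sum_mul h2y h2z
  have hF : 2 * (x + w) ^ 2 * (x - y) * (x - z) / x ^ 2 ≠ 0 := by
    have := sub_ne_zero.2 hxy
    have := sub_ne_zero.2 hxz
    positivity
  have hF' : 2 * (x + w) ^ 2 * (x - z) * (x - y) / x ^ 2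
      = 2 * (x + w) ^ 2 * (x - y) * (x - z) / x ^ 2 := by ring
  rw [hF']
  generalize 2 * (x + w) ^ 2 * (x - y) * (x - z) / x ^ 2 = F at hF
  rw [one_div_mul_eq_div, div_eq_iff (by positivity)]
  linear_combination -F ^ 2 / 8 * hsum

/-- the central invariants of the bihamiltonian structure (P₁, P₂) of
the (2,1)-type RR2T are all equal to 1/24. -/
theorem central_invariants_P1_P2 (u v w : ℝ) (hw : w ≠ 0) (lam : Fin 3 → ℝ)
    (hroot : ∀ i, Pchar u v w (lam i) = 0)
    (hdist : Function.Injective lam)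
    (hf : ∀ i, quadF (etaU u v w) (Jvec u v w (lam i)) (Jvec u v w (lam i)) ≠ 0)
    (i : Fin 3) :
    (1 / (3 * (quadF (etaU u v w) (Jvec u v w (lam i)) (Jvec u v w (lam i)))^2)) *
      (quadF (K2 u v w) (Jvec u v w (lam i)) (Jvec u v w (lam i))
        - lam i * quadF (K1 u v w) (Jvec u v w (lam i)) (Jvec u v w (lam i))
        + ∑ k ∈ Finset.univ.erase i,
            (quadF (H2 u v w) (Jvec u v w (lam k)) (Jvec u v w (lam i))
              - lam i * quadF (H1 u v w) (Jvec u v w (lam k)) (Jvec u v w (lam i)))^2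
              / (quadF (etaU u v w) (Jvec u v w (lam k)) (Jvec u v w (lam k))
                  * (lam k - lam i)))
      = 1/24 := by
  choose a hc hl using fun j => exists_double_root (hroot j)
  have hinj : Function.Injective a := fun j k hjk => hdist (by rw [hl j, hl k, hjk])
  have hcrit : ∀ j, 2 * a j ^ 3 + (u - 3 * w) * a j ^ 2 - 2 * u * w * a j - v * w = 0 :=
    fun j => by linear_combination -hc j + (w - a j) * hl j
  have htriple : ∀ {j k l : Fin 3}, j ≠ k → j ≠ l → k ≠ l →
      IsCritTriple u v w (a j - w) (a k - w) (a l - w) := fun hjk hjl hkl =>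
    isCritTriple_of_distinct (hcrit _) (hcrit _) (hcrit _) (hinj.ne hjk) (hinj.ne hjl)
      (hinj.ne hkl)
  have hsub : ∀ {j k : Fin 3}, j ≠ k → a j - w ≠ a k - w := fun hjk =>
    sub_left_injective.ne (hinj.ne hjk)
  have hx : ∀ j, a j - w ≠ 0 := by
    intro j
    obtain ⟨k, l, hjk, hjl, hkl⟩ : ∃ k l : Fin 3, j ≠ k ∧ j ≠ l ∧ k ≠ l := by
      revert j
      decide
    exact ((htriple hjk hjl hkl).nondegenerate (hsub hjk) (hsub hjl) (hsub hkl)).1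
  have hval : ∀ j, critVal u v w (a j - w) = lam j := fun j => by
    rw [critVal, sub_add_cancel, hl j]
  have hgrad : ∀ j, Jvec u v w (lam j) = critGrad u v w (a j - w) := fun j => by
    rw [Jvec_eq hw (hx j) (PcharX_ne_zero (hf j)) (hc j) (hl j), critGrad, hval,
      sub_add_cancel]
  have ha : ∀ j, a j - w + w ≠ 0 := by
    intro j h0
    apply hf j
    rw [hgrad]
    simp [quadF, etaU, critGrad, Fin.sum_univ_three, h0]
  obtain ⟨k, l, hjk, hjl, hkl, hs⟩ :
      ∃ k l : Fin 3, i ≠ k ∧ i ≠ l ∧ k ≠ l ∧ Finset.univ.erase i = {k, l} := by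
    clear * -
    revert i
    decide
  rw [hs, Finset.sum_pair hkl]
  simp only [hgrad]
  simp only [← hval]
  exact central_invariant_crit (htriple hjk hjl hkl) hw (hsub hjk) (hsub hjl) (hsub hkl)
    (ha _) (ha _) (ha _)
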